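/- Let Γ₁ ⊆ Γ₂ be Young diagrams with n and n+1 boxes respectively, and let I₁ = I_{Γ₁} ⊇ I₂ = I_{Γ₂} be the corresponding monomial ideals of R = ℂ[x,y]. Then dim_ℂ T(I₁,I₂) = 2n+2. -/

import Mathlib

/-!
Statement 10: for nested Young diagrams Γ₁ ⊆ Γ₂ with n and n+1 boxes and associated
monomial ideals I₁ = I_{Γ₁} ⊇ I₂ = I_{Γ₂} of ℂ[x,y], the flag tangent space T(I₁,I₂)
has dimension 2n+2.
-/

set_option synthInstance.maxHeartbeats 1000000
set_option maxHeartbeats 1000000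

noncomputable section

open MvPolynomial

/-- `R = ℂ[x,y]`. -/
abbrev Rxy : Type := MvPolynomial (Fin 2) ℂ

/-- The monomial ideal of `R = ℂ[x,y]` associated with a Young diagram `Γ`: the ideal
generated by the monomials `x^u y^v` with `(u,v) ∉ Γ`. -/
def monomialIdeal (Γ : YoungDiagram) : Ideal Rxy :=
  Ideal.span {m : Rxy | ∃ u v : ℕ, (u, v) ∉ Γ ∧ m = X 0 ^ u * X 1 ^ v}

/-- The canonical surjection `R⧸I → R⧸J` for nested ideals `I ≤ J`, as an `R`-linear map. -/
def quotFactor {I J : Ideal Rxy} (h : I ≤ J) : (Rxy ⧸ I) →ₗ[Rxy] Rxy ⧸ J :=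
  Submodule.mapQ I J LinearMap.id h

/-- The Zariski tangent space `T(I₁,I₂)` of the two-step flag Hilbert scheme at a flag
`I₂ ≤ I₁`: the space of pairs `(f,h) ∈ Hom_R(I₁,R/I₁) × Hom_R(I₂,R/I₂)` such that
`f(a) = π(h(a))` for all `a ∈ I₂`, where `π : R/I₂ → R/I₁` is the canonical surjection. -/
def flagTangent2 (I₁ I₂ : Ideal Rxy) (h : I₂ ≤ I₁) :
    Submodule Rxy ((I₁ →ₗ[Rxy] Rxy ⧸ I₁) × (I₂ →ₗ[Rxy] Rxy ⧸ I₂)) :=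
  LinearMap.ker
    (((LinearMap.lcomp Rxy (Rxy ⧸ I₁) (Submodule.inclusion h)).comp
        (LinearMap.fst Rxy (I₁ →ₗ[Rxy] Rxy ⧸ I₁) (I₂ →ₗ[Rxy] Rxy ⧸ I₂)))
      - ((LinearMap.llcomp Rxy I₂ (Rxy ⧸ I₂) (Rxy ⧸ I₁) (quotFactor h)).comp
        (LinearMap.snd Rxy (I₁ →ₗ[Rxy] Rxy ⧸ I₁) (I₂ →ₗ[Rxy] Rxy ⧸ I₂))))

section LinAlg
open Module

variable {V : Type*} [AddCommGroup V] [Module ℂ V]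

/-- The trace form on endomorphisms. -/
def trForm (V : Type*) [AddCommGroup V] [Module ℂ V] : LinearMap.BilinForm ℂ (Module.End ℂ V) :=
  (LinearMap.mul ℂ (Module.End ℂ V)).compr₂ (LinearMap.trace ℂ V)

lemma trForm_apply (A B : Module.End ℂ V) : trForm V A B = LinearMap.trace ℂ V (A * B) := rfl

lemma trace_rankOne [FiniteDimensional ℂ V] (D : Module.End ℂ V) (f : V →ₗ[ℂ] ℂ) (v : V) :
    LinearMap.trace ℂ V (D * (f.smulRight v : Module.End ℂ V)) = f (D v) := by
  have : D * (f.smulRight v : Module.End ℂ V) = f.smulRight (D v) := by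
    refine LinearMap.ext fun w => ?_
    simp
  rw [this, LinearMap.trace_smulRight]

lemma trForm_nondeg [FiniteDimensional ℂ V] : (trForm V).Nondegenerate := by
  have key : ∀ D : Module.End ℂ V, (∀ B, trForm V D B = 0) → D = 0 := by
    intro D hD
    ext v
    refine (Module.forall_dual_apply_eq_zero_iff ℂ (D v)).1 fun f => ?_
    rw [← trace_rankOne]
    exact hD _
  refine ⟨key, fun D hD => key D fun B => ?_⟩
  rw [trForm_apply, LinearMap.trace_mul_comm]
  exact hD B

/-- Endomorphisms preserving `L`. -/
def parab (L : Submodule ℂ V) : Submodule ℂ (Module.End ℂ V) where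
  carrier := {A | ∀ v ∈ L, A v ∈ L}
  add_mem' := fun ha hb v hv => L.add_mem (ha v hv) (hb v hv)
  zero_mem' := fun _ _ => L.zero_mem
  smul_mem' := fun c _ ha v hv => L.smul_mem c (ha v hv)

/-- Endomorphisms with image in `L` killing `L`. -/
def nilr (L : Submodule ℂ V) : Submodule ℂ (Module.End ℂ V) where
  carrier := {A | (∀ v, A v ∈ L) ∧ ∀ v ∈ L, A v = 0}
  add_mem' := fun ha hb => ⟨fun v => L.add_mem (ha.1 v) (hb.1 v), fun v hv => by
    simp [ha.2 v hv, hb.2 v hv]⟩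
  zero_mem' := ⟨fun _ => L.zero_mem, fun v _ => rfl⟩
  smul_mem' := fun c _ ha => ⟨fun v => L.smul_mem c (ha.1 v), fun v hv => by
    simp [ha.2 v hv]⟩

/-- Endomorphisms with image in `L`. -/
def homL (L : Submodule ℂ V) : Submodule ℂ (Module.End ℂ V) where
  carrier := {A | ∀ v, A v ∈ L}
  add_mem' := fun ha hb v => L.add_mem (ha v) (hb v)
  zero_mem' := fun _ => L.zero_mem
  smul_mem' := fun c _ ha v => L.smul_mem c (ha v)

lemma finrank_homL [FiniteDimensional ℂ V] (L : Submodule ℂ V) (hL : finrank ℂ L = 1) :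
    finrank ℂ (homL L) = finrank ℂ V := by
  let e : (V →ₗ[ℂ] L) ≃ₗ[ℂ] homL L :=
    { toFun := fun f => ⟨L.subtype ∘ₗ f, fun v => (f v).2⟩
      map_add' := fun f g => by ext; rfl
      map_smul' := fun c f => by ext; rfl
      invFun := fun f => LinearMap.codRestrict L f.1 f.2
      left_inv := fun f => by ext; rfl
      right_inv := fun f => by ext; rfl }
  rw [← e.finrank_eq, Module.finrank_linearMap, hL, mul_one]

lemma finrank_nilr [FiniteDimensional ℂ V] (L : Submodule ℂ V) (hL : finrank ℂ L = 1) :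
    finrank ℂ (nilr L) + 1 = finrank ℂ V := by
  let e : ((V ⧸ L) →ₗ[ℂ] L) ≃ₗ[ℂ] nilr L :=
    { toFun := fun f => ⟨L.subtype ∘ₗ f ∘ₗ L.mkQ, fun v => (f _).2, fun v hv => by
        have : L.mkQ v = 0 := by simpa using hv
        simp only [LinearMap.comp_apply, this, map_zero]⟩
      map_add' := fun f g => by ext; rfl
      map_smul' := fun c f => by ext; rfl
      invFun := fun f => L.liftQ (LinearMap.codRestrict L f.1 f.2.1) (fun v hv => by
        ext; exact f.2.2 v hv)
      left_inv := fun f => by ext; rfl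
      right_inv := fun f => by ext; rfl }
  rw [← e.finrank_eq, Module.finrank_linearMap, hL, mul_one, ← L.finrank_quotient_add_finrank, hL]

lemma orth_parab [FiniteDimensional ℂ V] (L : Submodule ℂ V) (D : Module.End ℂ V) :
    D ∈ nilr L ↔ ∀ B ∈ parab L, LinearMap.trace ℂ V (D * B) = 0 := by
  constructor
  · intro hD B hB
    have hn : IsNilpotent (D * B) := by
      refine ⟨2, ?_⟩
      ext v
      rw [pow_two]
      exact hD.2 _ (hB _ (hD.1 _))
    exact (LinearMap.isNilpotent_trace_of_isNilpotent hn).eq_zero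
  · intro hD
    refine ⟨fun v => ?_, fun v hv => ?_⟩
    · by_contra hv
      obtain ⟨f, hf, hfL⟩ := Submodule.exists_le_ker_of_notMem hv
      apply hf
      rw [← trace_rankOne]
      refine hD _ fun w hw => ?_
      have : f w = 0 := hfL hw
      simp [this]
    · refine (Module.forall_dual_apply_eq_zero_iff ℂ (D v)).1 fun f => ?_
      rw [← trace_rankOne]
      refine hD _ fun w hw => ?_
      simpa using L.smul_mem _ hv

lemma finrank_parab [FiniteDimensional ℂ V] (L : Submodule ℂ V) :
    finrank ℂ (parab L) + finrank ℂ (nilr L) = finrank ℂ (Module.End ℂ V) := by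
  have h1 := LinearMap.BilinForm.finrank_add_finrank_orthogonal' (B := trForm V) (parab L)
  rw [trForm_nondeg.ker_eq_bot, inf_bot_eq, finrank_bot, add_zero] at h1
  rw [← h1]
  have : nilr L = (trForm V).orthogonal (parab L) := by
    ext D
    rw [orth_parab, LinearMap.BilinForm.mem_orthogonal_iff]
    refine forall₂_congr fun B _ => ?_
    rw [trForm_apply, LinearMap.trace_mul_comm]
  rw [this]

/-- The commutator map. -/
def comMap (L : Submodule ℂ V) (X Y : Module.End ℂ V) :
    (parab L × parab L) →ₗ[ℂ] Module.End ℂ V where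
  toFun := fun p => (X * p.2.1 - p.2.1 * X) - (Y * p.1.1 - p.1.1 * Y)
  map_add' := fun p q => by
    simp only [Prod.fst_add, Prod.snd_add, Submodule.coe_add, mul_add, add_mul]; abel
  map_smul' := fun c p => by
    simp [smul_sub]

/-- The orthogonal of the range of the commutator map. -/
def quo (L : Submodule ℂ V) (X Y : Module.End ℂ V) : Submodule ℂ (Module.End ℂ V) where
  carrier := {C | C * X - X * C ∈ nilr L ∧ C * Y - Y * C ∈ nilr L}
  add_mem' := fun {a b} ha hb => ⟨by
    have := (nilr L).add_mem ha.1 hb.1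
    convert this using 1; simp only [mul_add, add_mul]; abel, by
    have := (nilr L).add_mem ha.2 hb.2
    convert this using 1; simp only [mul_add, add_mul]; abel⟩
  zero_mem' := by simp
  smul_mem' := fun c a ha => ⟨by
    have := (nilr L).smul_mem c ha.1
    convert this using 1; simp [smul_sub], by
    have := (nilr L).smul_mem c ha.2
    convert this using 1; simp [smul_sub]⟩

lemma quo_eq [FiniteDimensional ℂ V] (L : Submodule ℂ V) (X Y : Module.End ℂ V) :
    quo L X Y = (trForm V).orthogonal (LinearMap.range (comMap L X Y)) := by
  have key : ∀ C B X : Module.End ℂ V, LinearMap.trace ℂ V ((X * B - B * X) * C) =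
      LinearMap.trace ℂ V ((C * X - X * C) * B) := by
    intro C B X
    simp only [sub_mul, map_sub]
    rw [LinearMap.trace_mul_cycle, LinearMap.trace_mul_comm ℂ (B * X), ← mul_assoc,
      LinearMap.trace_mul_comm ℂ (X * C)]
    simp only [mul_assoc]
    rw [LinearMap.trace_mul_comm ℂ C (B * X)]
    simp only [mul_assoc]
  ext C
  rw [LinearMap.BilinForm.mem_orthogonal_iff]
  constructor
  · rintro ⟨h1, h2⟩ _ ⟨p, rfl⟩
    rw [trForm_apply]
    simp only [comMap, LinearMap.coe_mk, AddHom.coe_mk]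
    rw [sub_mul, map_sub, key C _ X, key C _ Y, (orth_parab L _).1 h1 _ p.2.2,
      (orth_parab L _).1 h2 _ p.1.2, sub_zero]
  · intro h
    refine ⟨(orth_parab L _).2 fun B hB => ?_, (orth_parab L _).2 fun B hB => ?_⟩
    · have := h _ ⟨(0, ⟨B, hB⟩), rfl⟩
      rw [trForm_apply] at this
      simp only [comMap, LinearMap.coe_mk, AddHom.coe_mk] at this
      rw [← key]
      simpa using this
    · have := h _ ⟨(⟨B, hB⟩, 0), rfl⟩
      rw [trForm_apply] at this
      simp only [comMap, LinearMap.coe_mk, AddHom.coe_mk] at this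
      rw [← key]
      have h2 := neg_eq_zero.2 this
      simpa [sub_mul] using h2

lemma finrank_quo [FiniteDimensional ℂ V] (L : Submodule ℂ V) (hL : finrank ℂ L = 1)
    (X Y : Module.End ℂ V) (hX : X ∈ parab L) (hY : Y ∈ parab L) (v : V)
    (hcyc : ∀ S : Submodule ℂ V, v ∈ S → (∀ w ∈ S, X w ∈ S) → (∀ w ∈ S, Y w ∈ S) → S = ⊤)
    (hmul : ∀ w, ∃ C : Module.End ℂ V, C v = w ∧ C * X = X * C ∧ C * Y = Y * C) :
    finrank ℂ (quo L X Y) + 1 = 2 * finrank ℂ V := by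
  let ev : quo L X Y →ₗ[ℂ] V ⧸ L := (L.mkQ ∘ₗ LinearMap.applyₗ v) ∘ₗ (quo L X Y).subtype
  have hev : ∀ C, ev C = L.mkQ (C.1 v) := fun _ => rfl
  have hsurj : LinearMap.range ev = ⊤ := by
    rw [LinearMap.range_eq_top]
    intro w
    obtain ⟨w, rfl⟩ := L.mkQ_surjective w
    obtain ⟨C, h1, h2, h3⟩ := hmul w
    refine ⟨⟨C, ?_, ?_⟩, ?_⟩
    · rw [h2, sub_self]; exact zero_mem _
    · rw [h3, sub_self]; exact zero_mem _
    · rw [hev, h1]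
  have hsub : ∀ Z ∈ parab L, ∀ C ∈ homL L, C * Z - Z * C ∈ nilr L := by
    intro Z hZ C hC
    refine ⟨fun w => L.sub_mem (hC _) (hZ _ (hC _)), fun w hw => ?_⟩
    obtain ⟨l, hl0, hl⟩ := finrank_eq_one_iff'.1 hL
    have hl' : ∀ w ∈ L, ∃ c : ℂ, w = c • (l : V) := fun w hw => by
      obtain ⟨c, hc⟩ := hl ⟨w, hw⟩
      exact ⟨c, by rw [← Submodule.coe_smul, hc]⟩
    obtain ⟨a, rfl⟩ := hl' w hw
    obtain ⟨b, hb⟩ := hl' _ (hZ _ l.2)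
    obtain ⟨c, hc⟩ := hl' _ (hC l)
    simp [hb, hc, smul_smul, mul_comm]
  have hker : (LinearMap.ker ev).map (quo L X Y).subtype = homL L := by
    ext C
    constructor
    · rintro ⟨⟨C, hC⟩, hC2, rfl⟩
      have hv : C v ∈ L := by simpa [hev] using hC2
      have step : ∀ Z ∈ parab L, C * Z - Z * C ∈ nilr L → ∀ w, C w ∈ L → C (Z w) ∈ L := by
        intro Z hZ hCZ w hw
        have := L.add_mem (hCZ.1 w) (hZ _ hw)
        simpa using this
      have := hcyc (L.comap C) hv (step X hX hC.1) (step Y hY hC.2)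
      intro w
      have hw : w ∈ L.comap C := this ▸ Submodule.mem_top
      exact hw
    · intro hC
      refine ⟨⟨C, hsub X hX C hC, hsub Y hY C hC⟩, ?_, rfl⟩
      have := hC v
      simpa [hev] using this
  have h1 := LinearMap.finrank_range_add_finrank_ker ev
  rw [hsurj, finrank_top] at h1
  have h2 : finrank ℂ (LinearMap.ker ev) = finrank ℂ V := by
    rw [← finrank_homL L hL, ← hker]
    exact (LinearEquiv.finrank_eq (Submodule.equivMapOfInjective _
      (quo L X Y).injective_subtype _))
  have h3 := L.finrank_quotient_add_finrank
  omega

lemma finrank_ker_comMap [FiniteDimensional ℂ V] (L : Submodule ℂ V) (hL : finrank ℂ L = 1)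
    (X Y : Module.End ℂ V) (hX : X ∈ parab L) (hY : Y ∈ parab L) (v : V)
    (hcyc : ∀ S : Submodule ℂ V, v ∈ S → (∀ w ∈ S, X w ∈ S) → (∀ w ∈ S, Y w ∈ S) → S = ⊤)
    (hmul : ∀ w, ∃ C : Module.End ℂ V, C v = w ∧ C * X = X * C ∧ C * Y = Y * C) :
    finrank ℂ (LinearMap.ker (comMap L X Y)) = finrank ℂ (parab L) + finrank ℂ V := by
  have h1 := LinearMap.finrank_range_add_finrank_ker (comMap L X Y)
  have h2 := LinearMap.BilinForm.finrank_add_finrank_orthogonal' (B := trForm V)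
    (LinearMap.range (comMap L X Y))
  rw [trForm_nondeg.ker_eq_bot, inf_bot_eq, finrank_bot, add_zero, ← quo_eq] at h2
  have h3 := finrank_quo L hL X Y hX hY v hcyc hmul
  have h4 := finrank_parab L
  have h5 := finrank_nilr L hL
  rw [Module.finrank_prod] at h1
  omega

lemma count_rank {H P U T A : Type} [AddCommGroup H] [Module ℂ H] [AddCommGroup P] [Module ℂ P]
    [AddCommGroup U] [Module ℂ U] [AddCommGroup T] [Module ℂ T] [AddCommGroup A] [Module ℂ A]
    [FiniteDimensional ℂ P] [FiniteDimensional ℂ U]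
    (ψ : H →ₗ[ℂ] P) (e : H →ₗ[ℂ] U) (ρ : H →ₗ[ℂ] T) (κ : A →ₗ[ℂ] H) (K : Submodule ℂ P)
    (hr : LinearMap.range ψ = K) (hinj : ∀ g, ψ g = 0 → e g = 0 → g = 0)
    (hsurj : ∀ w, ∃ g, ψ g = 0 ∧ e g = w) (hρ : Function.Surjective ρ)
    (hκ : Function.Injective κ) (hκρ' : ∀ g, (∃ a, κ a = g) ↔ ρ g = 0)
    (hK : finrank ℂ K = finrank ℂ A + finrank ℂ U) :
    Module.rank ℂ T = ((2 * finrank ℂ U : ℕ) : Cardinal) := by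
  have hκρ : LinearMap.range κ = LinearMap.ker ρ := by
    ext g
    exact hκρ' g
  let e' : LinearMap.ker ψ ≃ₗ[ℂ] U := LinearEquiv.ofBijective (e ∘ₗ (LinearMap.ker ψ).subtype) (by
    constructor
    · rw [injective_iff_map_eq_zero]
      intro g hg
      exact Subtype.ext (hinj g.1 g.2 hg)
    · intro w
      obtain ⟨g, h1, h2⟩ := hsurj w
      exact ⟨⟨g, h1⟩, h2⟩)
  have : Module.Finite ℂ (LinearMap.ker ψ) := Module.Finite.equiv e'.symm
  have : Module.Finite ℂ (H ⧸ LinearMap.ker ψ) := Module.Finite.equiv ψ.quotKerEquivRange.symm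
  have : Module.Finite ℂ H := Module.Finite.of_submodule_quotient (LinearMap.ker ψ)
  have : Module.Finite ℂ T := Module.Finite.of_surjective ρ hρ
  have h1 := LinearMap.finrank_range_add_finrank_ker ψ
  rw [e'.finrank_eq, hr, hK] at h1
  have h2 := LinearMap.finrank_range_add_finrank_ker ρ
  rw [LinearMap.range_eq_top.2 hρ, finrank_top, ← hκρ, LinearMap.finrank_range_of_inj hκ] at h2
  rw [← Module.finrank_eq_rank]
  congr 1
  omega

end LinAlg

section Colength
open Module

lemma monomial_eq_xy (m : Fin 2 →₀ ℕ) :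
    (monomial m (1 : ℂ)) = (X 0 ^ (m 0) * X 1 ^ (m 1) : Rxy) := by
  have : Finsupp.single 0 (m 0) + Finsupp.single 1 (m 1) = m := by
    ext i
    fin_cases i <;> simp
  rw [X_pow_eq_monomial, X_pow_eq_monomial, monomial_mul, mul_one, this]

lemma mem_monomialIdeal (Γ : YoungDiagram) (p : Rxy) :
    p ∈ monomialIdeal Γ ↔ ∀ m ∈ p.support, (m 0, m 1) ∉ Γ := by
  have hset : {m : Rxy | ∃ u v : ℕ, (u, v) ∉ Γ ∧ m = X 0 ^ u * X 1 ^ v} =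
      (fun s => monomial s (1 : ℂ)) '' {m : Fin 2 →₀ ℕ | (m 0, m 1) ∉ Γ} := by
    ext q
    constructor
    · rintro ⟨u, v, huv, rfl⟩
      refine ⟨Finsupp.single 0 u + Finsupp.single 1 v, ?_, ?_⟩
      · simpa using huv
      · simp [X_pow_eq_monomial, monomial_mul]
    · rintro ⟨m, hm, rfl⟩
      refine ⟨m 0, m 1, hm, ?_⟩
      exact monomial_eq_xy m
  rw [monomialIdeal, hset, mem_ideal_span_monomial_image]
  refine forall₂_congr fun m _ => ⟨?_, fun h => ⟨m, h, le_rfl⟩⟩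
  rintro ⟨s, hs, hsm⟩ hm
  exact hs (Γ.up_left_mem (hsm 0) (hsm 1) hm)

lemma colength (Γ : YoungDiagram) :
    Module.Finite ℂ (Rxy ⧸ monomialIdeal Γ) ∧ finrank ℂ (Rxy ⧸ monomialIdeal Γ) = Γ.card := by
  let c : Rxy →ₗ[ℂ] (Γ.cells → ℂ) := LinearMap.pi fun b =>
    lcoeff ℂ (Finsupp.single 0 b.1.1 + Finsupp.single 1 b.1.2)
  have hc : ∀ p b, c p b = coeff (Finsupp.single 0 b.1.1 + Finsupp.single 1 b.1.2) p :=
    fun _ _ => rfl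
  have hm : ∀ m : Fin 2 →₀ ℕ, Finsupp.single 0 (m 0) + Finsupp.single 1 (m 1) = m := by
    intro m
    ext i
    fin_cases i <;> simp
  have hker : LinearMap.ker c = (monomialIdeal Γ).restrictScalars ℂ := by
    ext p
    rw [Submodule.restrictScalars_mem, mem_monomialIdeal, LinearMap.mem_ker]
    constructor
    · intro h m hmp hmΓ
      have := congrFun h ⟨(m 0, m 1), hmΓ⟩
      rw [hc, hm] at this
      exact (mem_support_iff.1 hmp) this
    · intro h
      funext b
      rw [hc]
      by_contra hb
      have := h _ (mem_support_iff.2 hb)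
      apply this
      simp
  have hsurj : Function.Surjective c := by
    intro f
    refine ⟨∑ b : Γ.cells, monomial (Finsupp.single 0 b.1.1 + Finsupp.single 1 b.1.2) (f b), ?_⟩
    funext b
    rw [hc, coeff_sum]
    simp only [coeff_monomial]
    rw [Finset.sum_eq_single b]
    · simp
    · intro b' _ hb'
      rw [if_neg]
      intro heq
      apply hb'
      have h0 := DFunLike.congr_fun heq 0
      have h1 := DFunLike.congr_fun heq 1
      simp at h0 h1
      exact Subtype.ext (Prod.ext h0 h1)
    · simp
  let e : (Rxy ⧸ monomialIdeal Γ) ≃ₗ[ℂ] (Γ.cells → ℂ) :=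
    (Submodule.Quotient.restrictScalarsEquiv ℂ (monomialIdeal Γ)).symm ≪≫ₗ
      (Submodule.quotEquivOfEq _ _ hker.symm ≪≫ₗ c.quotKerEquivOfSurjective hsurj)
  refine ⟨Module.Finite.equiv e.symm, ?_⟩
  rw [e.finrank_eq, Module.finrank_fintype_fun_eq_card]
  simp [YoungDiagram.card]

end Colength

section Prim
open Module

variable {V : Type} [AddCommGroup V] [Module ℂ V] [Module Rxy V] [IsScalarTower ℂ Rxy V]

/-- Primitive of a compatible pair, on monomials. -/
def prim0 (q : Rxy →ₗ[Rxy] V) (A B : Module.End ℂ V) : ℕ → ℕ → V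
  | 0, 0 => 0
  | 0, j + 1 => (X 1 : Rxy) • prim0 q A B 0 j +
      B (q (X 0 ^ 0 * X 1 ^ j))
  | i + 1, j => (X 0 : Rxy) • prim0 q A B i j +
      A (q (X 0 ^ i * X 1 ^ j))

lemma prim0_x (q : Rxy →ₗ[Rxy] V) (A B : Module.End ℂ V) (i j : ℕ) :
    prim0 q A B (i + 1) j = (X 0 : Rxy) • prim0 q A B i j +
      A (q (X 0 ^ i * X 1 ^ j)) := by
  rw [prim0]

lemma prim0_y (q : Rxy →ₗ[Rxy] V) (A B : Module.End ℂ V)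
    (hAB : ∀ v : V, (X 0 : Rxy) • B v - B ((X 0 : Rxy) • v) = (X 1 : Rxy) • A v - A ((X 1 : Rxy) • v))
    (i j : ℕ) :
    prim0 q A B i (j + 1) = (X 1 : Rxy) • prim0 q A B i j +
      B (q (X 0 ^ i * X 1 ^ j)) := by
  induction i with
  | zero => rw [prim0]
  | succ i ih =>
    rw [prim0_x, prim0_x, ih]
    have h1 : (q (X 0 ^ i * X 1 ^ (j + 1)) ) =
        (X 1 : Rxy) • q (X 0 ^ i * X 1 ^ j) := by
      rw [← map_smul, smul_eq_mul]
      congr 1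
      ring
    have h2 : (q (X 0 ^ (i + 1) * X 1 ^ j) ) =
        (X 0 : Rxy) • q (X 0 ^ i * X 1 ^ j) := by
      rw [← map_smul, smul_eq_mul]
      congr 1
      ring
    rw [h1, h2, smul_add, smul_add, smul_comm (X 1 : Rxy) (X 0 : Rxy), add_assoc, add_assoc]
    congr 1
    rw [← sub_eq_sub_iff_add_eq_add]
    exact hAB _

lemma exists_prim (q : Rxy →ₗ[Rxy] V) (A B : Module.End ℂ V)
    (hAB : ∀ v : V, (X 0 : Rxy) • B v - B ((X 0 : Rxy) • v) = (X 1 : Rxy) • A v - A ((X 1 : Rxy) • v)) :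
    ∃ g : Rxy →ₗ[ℂ] V,
      (∀ r, g (X 0 * r) = (X 0 : Rxy) • g r + A (q r)) ∧
      (∀ r, g (X 1 * r) = (X 1 : Rxy) • g r + B (q r)) := by
  obtain ⟨g, hg⟩ : ∃ g : Rxy →ₗ[ℂ] V,
      ∀ m : Fin 2 →₀ ℕ, g (monomial m 1) = prim0 q A B (m 0) (m 1) := by
    refine ⟨(basisMonomials (Fin 2) ℂ).constr ℂ (fun m => prim0 q A B (m 0) (m 1)), fun m => ?_⟩
    rw [← congrFun (coe_basisMonomials (Fin 2) ℂ) m]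
    exact Basis.constr_basis _ _ _ _
  have hm : ∀ m : Fin 2 →₀ ℕ, (monomial m (1 : ℂ)) = X 0 ^ (m 0) * X 1 ^ (m 1) := by
    intro m
    exact monomial_eq_xy m
  have ext0 : ∀ f₁ f₂ : Rxy →ₗ[ℂ] V,
      (∀ m, f₁ (monomial m 1) = f₂ (monomial m 1)) → f₁ = f₂ := by
    intro f₁ f₂ hf
    refine (basisMonomials (Fin 2) ℂ).ext fun m => ?_
    simpa using hf m
  have hx : g ∘ₗ LinearMap.mulLeft ℂ (X 0) = (Algebra.lsmul ℂ ℂ V (X 0 : Rxy)) ∘ₗ g + A ∘ₗ q.restrictScalars ℂ := by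
    refine ext0 _ _ fun m => ?_
    simp only [LinearMap.comp_apply, LinearMap.add_apply, LinearMap.mulLeft_apply,
      Algebra.lsmul_coe, LinearMap.restrictScalars_apply]
    have : (X 0 * monomial m 1 : Rxy) = monomial (Finsupp.single 0 1 + m) 1 := by
      rw [X, monomial_mul, one_mul]
    rw [this, hg, hg, hm]
    simp only [Finsupp.add_apply]
    simp [add_comm 1, prim0_x]
  have hy : g ∘ₗ LinearMap.mulLeft ℂ (X 1) = (Algebra.lsmul ℂ ℂ V (X 1 : Rxy)) ∘ₗ g + B ∘ₗ q.restrictScalars ℂ := by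
    refine ext0 _ _ fun m => ?_
    simp only [LinearMap.comp_apply, LinearMap.add_apply, LinearMap.mulLeft_apply,
      Algebra.lsmul_coe, LinearMap.restrictScalars_apply]
    have : (X 1 * monomial m 1 : Rxy) = monomial (Finsupp.single 1 1 + m) 1 := by
      rw [X, monomial_mul, one_mul]
    rw [this, hg, hg, hm]
    simp only [Finsupp.add_apply]
    simp [add_comm 1, prim0_y q A B hAB]
  exact ⟨g, fun r => LinearMap.congr_fun hx r, fun r => LinearMap.congr_fun hy r⟩

end Prim

section Tangent
open Module

variable {I₁ I₂ : Ideal Rxy} (h : I₂ ≤ I₁)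

lemma quotFactor_mk (r : Rxy) :
    quotFactor h (Submodule.Quotient.mk r) = Submodule.Quotient.mk r := rfl

lemma quotFactor_surj : Function.Surjective (quotFactor h) := by
  intro w
  obtain ⟨r, rfl⟩ := Submodule.Quotient.mk_surjective _ w
  exact ⟨Submodule.Quotient.mk r, rfl⟩

/-- `I₁ / I₂` inside `R / I₂`. -/
def lineL : Submodule ℂ (Rxy ⧸ I₂) := (LinearMap.ker (quotFactor h)).restrictScalars ℂ

lemma mem_lineL (v : Rxy ⧸ I₂) : v ∈ lineL h ↔ quotFactor h v = 0 := Iff.rfl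

lemma mk_mem_lineL (r : Rxy) : (Submodule.Quotient.mk r : Rxy ⧸ I₂) ∈ lineL h ↔ r ∈ I₁ := by
  rw [mem_lineL, quotFactor_mk, Submodule.Quotient.mk_eq_zero]

/-- Multiplication on the quotient. -/
def mulE (I₂ : Ideal Rxy) (r : Rxy) : Module.End ℂ (Rxy ⧸ I₂) :=
  Algebra.lsmul ℂ ℂ (Rxy ⧸ I₂) r

lemma mulE_apply (r : Rxy) (v : Rxy ⧸ I₂) : mulE I₂ r v = r • v := rfl

lemma mulE_mem (r : Rxy) : mulE I₂ r ∈ parab (lineL h) := by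
  intro v hv
  rw [mem_lineL] at hv ⊢
  rw [mulE_apply, map_smul, hv, smul_zero]

/-- `ℂ`-linear maps `R → R / I₂` inducing a pair in the tangent space. -/
def tanH : Submodule ℂ (Rxy →ₗ[ℂ] Rxy ⧸ I₂) where
  carrier := {g | (∀ r : Rxy, ∀ a ∈ I₂, g (r * a) = r • g a) ∧
    ∀ r : Rxy, ∀ a ∈ I₁, quotFactor h (g (r * a)) = r • quotFactor h (g a)}
  add_mem' := fun {f g} hf hg => ⟨fun r a ha => by
      simp [hf.1 r a ha, hg.1 r a ha], fun r a ha => by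
      simp [hf.2 r a ha, hg.2 r a ha]⟩
  zero_mem' := ⟨fun r a _ => by simp, fun r a _ => by simp⟩
  smul_mem' := fun c f hf => ⟨fun r a ha => by
      simp only [LinearMap.smul_apply, hf.1 r a ha]
      exact smul_comm _ _ _, fun r a ha => by
      simp only [LinearMap.smul_apply, LinearMap.map_smul_of_tower, hf.2 r a ha]
      exact smul_comm _ _ _⟩

/-- The commutator of `g` with multiplication by `c`. -/
def der (s : (Rxy ⧸ I₂) →ₗ[ℂ] Rxy) (c : Rxy) :
    (Rxy →ₗ[ℂ] Rxy ⧸ I₂) →ₗ[ℂ] Module.End ℂ (Rxy ⧸ I₂) where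
  toFun := fun g => (g ∘ₗ LinearMap.mulLeft ℂ c - mulE I₂ c ∘ₗ g) ∘ₗ s
  map_add' := fun f g => by
    refine LinearMap.ext fun v => ?_
    simp only [LinearMap.comp_apply, LinearMap.sub_apply, LinearMap.add_apply, map_add]
    abel
  map_smul' := fun a g => by
    refine LinearMap.ext fun v => ?_
    simp [smul_sub]

lemma der_mk (s : (Rxy ⧸ I₂) →ₗ[ℂ] Rxy) (hs : ∀ v, Submodule.Quotient.mk (s v) = v) (c : Rxy)
    (g : Rxy →ₗ[ℂ] Rxy ⧸ I₂) (hg : g ∈ tanH h) (r : Rxy) :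
    der s c g (Submodule.Quotient.mk r) = g (c * r) - c • g r := by
  have h1 : s (Submodule.Quotient.mk r) - r ∈ I₂ := by
    rw [← Submodule.Quotient.eq, hs]
  have h2 := hg.1 c _ h1
  rw [mul_sub, map_sub, map_sub, smul_sub] at h2
  change g (c * s (Submodule.Quotient.mk r)) - c • g (s (Submodule.Quotient.mk r)) = _
  rw [sub_eq_sub_iff_sub_eq_sub, h2]

lemma der_mem (s : (Rxy ⧸ I₂) →ₗ[ℂ] Rxy) (hs : ∀ v, Submodule.Quotient.mk (s v) = v) (c : Rxy)
    (g : Rxy →ₗ[ℂ] Rxy ⧸ I₂) (hg : g ∈ tanH h) : der s c g ∈ parab (lineL h) := by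
  intro v hv
  obtain ⟨r, rfl⟩ := Submodule.Quotient.mk_surjective _ v
  rw [mk_mem_lineL] at hv
  rw [der_mk h s hs c g hg, mem_lineL, map_sub, map_smul, hg.2 c r hv, sub_self]

/-- `tanH → p × p`. -/
def psi (s : (Rxy ⧸ I₂) →ₗ[ℂ] Rxy) (hs : ∀ v, Submodule.Quotient.mk (s v) = v) :
    tanH h →ₗ[ℂ] parab (lineL h) × parab (lineL h) :=
  LinearMap.prod
    (LinearMap.codRestrict _ (der s (X 0) ∘ₗ (tanH h).subtype) fun g => der_mem h s hs _ g.1 g.2)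
    (LinearMap.codRestrict _ (der s (X 1) ∘ₗ (tanH h).subtype) fun g => der_mem h s hs _ g.1 g.2)

lemma psi_fst (s : (Rxy ⧸ I₂) →ₗ[ℂ] Rxy) (hs : ∀ v, Submodule.Quotient.mk (s v) = v)
    (g : tanH h) : (psi h s hs g).1.1 = der s (X 0) g.1 := rfl

lemma psi_snd (s : (Rxy ⧸ I₂) →ₗ[ℂ] Rxy) (hs : ∀ v, Submodule.Quotient.mk (s v) = v)
    (g : tanH h) : (psi h s hs g).2.1 = der s (X 1) g.1 := rfl

lemma prim_mem (A B : Module.End ℂ (Rxy ⧸ I₂)) (hA : A ∈ parab (lineL h))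
    (hB : B ∈ parab (lineL h)) (g : Rxy →ₗ[ℂ] Rxy ⧸ I₂)
    (hx : ∀ r, g (X 0 * r) = (X 0 : Rxy) • g r + A (Submodule.Quotient.mk r))
    (hy : ∀ r, g (X 1 * r) = (X 1 : Rxy) • g r + B (Submodule.Quotient.mk r)) :
    g ∈ tanH h := by
  constructor
  · intro r a ha
    induction r using MvPolynomial.induction_on with
    | C c => rw [C_mul', map_smul, ← algebraMap_eq, algebraMap_smul]
    | add p q hp hq => rw [add_mul, map_add, hp, hq, add_smul]
    | mul_X p i hp =>
      have h0 : (Submodule.Quotient.mk (p * a) : Rxy ⧸ I₂) = 0 :=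
        (Submodule.Quotient.mk_eq_zero _).2 (I₂.mul_mem_left _ ha)
      have h1 : p * X i * a = X i * (p * a) := by ring
      rw [h1, mul_comm p (X i), mul_smul, ← hp]
      fin_cases i
      · exact (hx _).trans (by rw [h0, map_zero, add_zero]; rfl)
      · exact (hy _).trans (by rw [h0, map_zero, add_zero]; rfl)
  · intro r a ha
    induction r using MvPolynomial.induction_on with
    | C c => rw [C_mul', map_smul, LinearMap.map_smul_of_tower, ← algebraMap_eq, algebraMap_smul]
    | add p q hp hq => rw [add_mul, map_add, map_add, hp, hq, add_smul]
    | mul_X p i hp =>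
      have h0 : (Submodule.Quotient.mk (p * a) : Rxy ⧸ I₂) ∈ lineL h :=
        (mk_mem_lineL h _).2 (I₁.mul_mem_left _ ha)
      have h1 : p * X i * a = X i * (p * a) := by ring
      have hA' := (mem_lineL h _).1 (hA _ h0)
      have hB' := (mem_lineL h _).1 (hB _ h0)
      rw [h1, mul_comm p (X i), mul_smul, ← hp]
      fin_cases i
      · exact (congrArg _ (hx _)).trans (by rw [map_add, hA', add_zero, map_smul]; rfl)
      · exact (congrArg _ (hy _)).trans (by rw [map_add, hB', add_zero, map_smul]; rfl)

lemma range_psi (s : (Rxy ⧸ I₂) →ₗ[ℂ] Rxy) (hs : ∀ v, Submodule.Quotient.mk (s v) = v) :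
    LinearMap.range (psi h s hs) =
      LinearMap.ker (comMap (lineL h) (mulE I₂ (X 0)) (mulE I₂ (X 1))) := by
  ext p
  constructor
  · rintro ⟨g, rfl⟩
    rw [LinearMap.mem_ker]
    refine LinearMap.ext fun v => ?_
    obtain ⟨r, rfl⟩ := Submodule.Quotient.mk_surjective _ v
    change (X 0 : Rxy) • der s (X 1) g.1 (Submodule.Quotient.mk r) -
      der s (X 1) g.1 (Submodule.Quotient.mk (X 0 * r)) -
      ((X 1 : Rxy) • der s (X 0) g.1 (Submodule.Quotient.mk r) -
      der s (X 0) g.1 (Submodule.Quotient.mk (X 1 * r))) = 0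
    simp only [der_mk h s hs _ g.1 g.2]
    rw [mul_left_comm, smul_sub, smul_sub, smul_comm (X 1 : Rxy) (X 0 : Rxy)]
    abel
  · intro hp
    obtain ⟨⟨A, hA⟩, ⟨B, hB⟩⟩ := p
    obtain ⟨g, hx, hy⟩ := exists_prim (Submodule.mkQ I₂) A B fun v => sub_eq_zero.1 (LinearMap.congr_fun hp v)
    have hg := prim_mem h A B hA hB g hx hy
    refine ⟨⟨g, hg⟩, Prod.ext (Subtype.ext ?_) (Subtype.ext ?_)⟩
    · rw [psi_fst]
      refine LinearMap.ext fun v => ?_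
      obtain ⟨r, rfl⟩ := Submodule.Quotient.mk_surjective _ v
      rw [der_mk h s hs _ g hg, hx, add_sub_cancel_left]
      rfl
    · rw [psi_snd]
      refine LinearMap.ext fun v => ?_
      obtain ⟨r, rfl⟩ := Submodule.Quotient.mk_surjective _ v
      rw [der_mk h s hs _ g hg, hy, add_sub_cancel_left]
      rfl

lemma ker_psi_inj (s : (Rxy ⧸ I₂) →ₗ[ℂ] Rxy) (hs : ∀ v, Submodule.Quotient.mk (s v) = v)
    (g : tanH h) (hg2 : psi h s hs g = 0) (h1 : g.1 1 = 0) : g = 0 := by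
  obtain ⟨g, hg⟩ := g
  have hX : ∀ (i : Fin 2) (r : Rxy), g (X i * r) = (X i : Rxy) • g r := by
    intro i r
    have ha : der s (X 0) g = 0 := congrArg (fun p : parab (lineL h) × parab (lineL h) => p.1.1) hg2
    have hb : der s (X 1) g = 0 := congrArg (fun p : parab (lineL h) × parab (lineL h) => p.2.1) hg2
    rw [← sub_eq_zero, ← der_mk h s hs _ g hg]
    fin_cases i
    · exact LinearMap.congr_fun ha _
    · exact LinearMap.congr_fun hb _
  have hz : ∀ r, g r = 0 := by
    intro r
    induction r using MvPolynomial.induction_on with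
    | C c => rw [← mul_one (C c), C_mul', map_smul, h1, smul_zero]
    | add p q hp hq => rw [map_add, hp, hq, add_zero]
    | mul_X p i hp => rw [mul_comm, hX, hp, smul_zero]
  exact Subtype.ext (LinearMap.ext hz)

lemma ker_psi_surj (s : (Rxy ⧸ I₂) →ₗ[ℂ] Rxy) (hs : ∀ v, Submodule.Quotient.mk (s v) = v)
    (w : Rxy ⧸ I₂) : ∃ g : tanH h, psi h s hs g = 0 ∧ g.1 1 = w := by
  let g : Rxy →ₗ[ℂ] Rxy ⧸ I₂ := (LinearMap.toSpanSingleton Rxy _ w).restrictScalars ℂ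
  have hgr : ∀ r, g r = r • w := fun _ => rfl
  have hg : g ∈ tanH h := ⟨fun r a _ => by rw [hgr, hgr, mul_smul], fun r a _ => by
    rw [hgr, hgr, mul_smul, map_smul]⟩
  have hd : ∀ c, der s c g = 0 := by
    intro c
    refine LinearMap.ext fun v => ?_
    obtain ⟨r, rfl⟩ := Submodule.Quotient.mk_surjective _ v
    rw [der_mk h s hs _ g hg, hgr, hgr, mul_smul, sub_self]
    rfl
  exact ⟨⟨g, hg⟩, Prod.ext (Subtype.ext (hd _)) (Subtype.ext (hd _)),
    (hgr 1).trans (one_smul _ _)⟩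

lemma mem_flagTangent2 (p : (I₁ →ₗ[Rxy] Rxy ⧸ I₁) × (I₂ →ₗ[Rxy] Rxy ⧸ I₂)) :
    p ∈ flagTangent2 I₁ I₂ h ↔ ∀ a : I₂, p.1 (Submodule.inclusion h a) = quotFactor h (p.2 a) := by
  rw [flagTangent2, LinearMap.mem_ker, LinearMap.ext_iff]
  exact forall_congr' fun a => sub_eq_zero

/-- Restriction to the tangent space. -/
def rho : tanH h →ₗ[ℂ] flagTangent2 I₁ I₂ h where
  toFun := fun g => ⟨({ toFun := fun a => quotFactor h (g.1 a.1)
                        map_add' := fun a b => by simp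
                        map_smul' := fun r a => g.2.2 r a.1 a.2 },
                      { toFun := fun a => g.1 a.1
                        map_add' := fun a b => by simp
                        map_smul' := fun r a => g.2.1 r a.1 a.2 }),
                      (mem_flagTangent2 h _).2 fun a => rfl⟩
  map_add' := fun f g => by
    refine Subtype.ext (Prod.ext (LinearMap.ext fun a => ?_) (LinearMap.ext fun a => ?_))
    · exact map_add (quotFactor h) (f.1 a.1) (g.1 a.1)
    · rfl
  map_smul' := fun c g => by
    refine Subtype.ext (Prod.ext (LinearMap.ext fun a => ?_) (LinearMap.ext fun a => ?_))
    · exact LinearMap.map_smul_of_tower (quotFactor h) c (g.1 a.1)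
    · rfl

lemma rho_fst (g : tanH h) (a : I₁) : (rho h g).1.1 a = quotFactor h (g.1 a.1) := rfl
lemma rho_snd (g : tanH h) (a : I₂) : (rho h g).1.2 a = g.1 a.1 := rfl

lemma exists_proj (I : Ideal Rxy) : ∃ P : Rxy →ₗ[ℂ] I, ∀ a : I, P a.1 = a := by
  obtain ⟨P, hP⟩ := LinearMap.exists_leftInverse_of_injective
    (I.subtype.restrictScalars ℂ) (LinearMap.ker_eq_bot.2 Subtype.val_injective)
  exact ⟨P, fun a => LinearMap.congr_fun hP a⟩

lemma rho_surj : Function.Surjective (rho h) := by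
  rintro ⟨⟨f, g⟩, hfg⟩
  rw [mem_flagTangent2] at hfg
  change ∀ a : I₂, f (Submodule.inclusion h a) = quotFactor h (g a) at hfg
  obtain ⟨P₁, hP₁⟩ := exists_proj I₁
  obtain ⟨P₂, hP₂⟩ := exists_proj I₂
  obtain ⟨s, hs⟩ := LinearMap.exists_rightInverse_of_surjective
    ((quotFactor h).restrictScalars ℂ) (LinearMap.range_eq_top.2 (quotFactor_surj h))
  have hs' : ∀ w, quotFactor h (s w) = w := fun w => LinearMap.congr_fun hs w
  let i₁ : I₁ →ₗ[ℂ] Rxy := I₁.subtype.restrictScalars ℂ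
  let i₂₁ : I₂ →ₗ[ℂ] I₁ := (Submodule.inclusion h).restrictScalars ℂ
  let f' : I₁ →ₗ[ℂ] Rxy ⧸ I₁ := f.restrictScalars ℂ
  let g' : I₂ →ₗ[ℂ] Rxy ⧸ I₂ := g.restrictScalars ℂ
  let Q : Rxy →ₗ[ℂ] I₂ := P₂ ∘ₗ i₁ ∘ₗ P₁
  let G : Rxy →ₗ[ℂ] Rxy ⧸ I₂ := g' ∘ₗ Q + s ∘ₗ f' ∘ₗ (P₁ - i₂₁ ∘ₗ Q)
  have hG : ∀ r, G r = g (P₂ (P₁ r).1) + s (f (P₁ r - Submodule.inclusion h (P₂ (P₁ r).1))) :=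
    fun _ => rfl
  have hG1 : ∀ a : I₁, quotFactor h (G a.1) = f a := by
    intro a
    rw [hG, hP₁, map_add, hs', map_sub, hfg, add_sub_cancel]
  have hG2 : ∀ a : I₂, G a.1 = g a := by
    intro a
    have : P₁ a.1 = Submodule.inclusion h a := hP₁ (Submodule.inclusion h a)
    rw [hG, this]
    have h2 : P₂ (Submodule.inclusion h a).1 = a := hP₂ a
    rw [h2, sub_self, map_zero, map_zero, add_zero]
  have hmem : G ∈ tanH h := by
    refine ⟨fun r a ha => ?_, fun r a ha => ?_⟩
    · have h1 := hG2 ⟨a, ha⟩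
      have h2 := hG2 (r • ⟨a, ha⟩)
      rw [map_smul, ← h1] at h2
      exact h2
    · have h1 := hG1 ⟨a, ha⟩
      have h2 := hG1 (r • ⟨a, ha⟩)
      rw [map_smul, ← h1] at h2
      exact h2
  refine ⟨⟨G, hmem⟩, Subtype.ext (Prod.ext (LinearMap.ext fun a => ?_)
    (LinearMap.ext fun a => ?_))⟩
  · exact hG1 a
  · exact hG2 a

/-- `p → tanH`. -/
def kappa : parab (lineL h) →ₗ[ℂ] tanH h where
  toFun := fun A => ⟨A.1 ∘ₗ (Submodule.mkQ I₂).restrictScalars ℂ, by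
    refine ⟨fun r a ha => ?_, fun r a ha => ?_⟩
    · have h1 : (Submodule.Quotient.mk a : Rxy ⧸ I₂) = 0 := (Submodule.Quotient.mk_eq_zero _).2 ha
      have h2 : (Submodule.Quotient.mk (r * a) : Rxy ⧸ I₂) = 0 :=
        (Submodule.Quotient.mk_eq_zero _).2 (I₂.mul_mem_left _ ha)
      change A.1 (Submodule.Quotient.mk (r * a)) = r • A.1 (Submodule.Quotient.mk a)
      rw [h1, h2, map_zero, smul_zero]
    · have h1 := (mem_lineL h _).1 (A.2 _ ((mk_mem_lineL h a).2 ha))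
      have h2 := (mem_lineL h _).1 (A.2 _ ((mk_mem_lineL h (r * a)).2 (I₁.mul_mem_left _ ha)))
      change quotFactor h (A.1 (Submodule.Quotient.mk (r * a))) =
        r • quotFactor h (A.1 (Submodule.Quotient.mk a))
      rw [h1, h2, smul_zero]⟩
  map_add' := fun A B => rfl
  map_smul' := fun c A => rfl

lemma kappa_apply (A : parab (lineL h)) (r : Rxy) :
    (kappa h A).1 r = A.1 (Submodule.Quotient.mk r) := rfl

lemma kappa_inj : Function.Injective (kappa h) := by
  intro A B hAB
  refine Subtype.ext (LinearMap.ext fun v => ?_)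
  obtain ⟨r, rfl⟩ := Submodule.Quotient.mk_surjective _ v
  rw [← kappa_apply, ← kappa_apply, hAB]

lemma range_kappa (s : (Rxy ⧸ I₂) →ₗ[ℂ] Rxy) (hs : ∀ v, Submodule.Quotient.mk (s v) = v) :
    ∀ g, (∃ a, kappa h a = g) ↔ rho h g = 0 := by
  intro g
  constructor
  · rintro ⟨A, rfl⟩
    refine Subtype.ext (Prod.ext (LinearMap.ext fun a => ?_) (LinearMap.ext fun a => ?_))
    · rw [rho_fst, kappa_apply]
      exact (mem_lineL h _).1 (A.2 _ ((mk_mem_lineL h _).2 a.2))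
    · rw [rho_snd, kappa_apply, (Submodule.Quotient.mk_eq_zero _).2 a.2, map_zero]
      rfl
  · intro hg
    have h1 : ∀ a : I₁, quotFactor h (g.1 a.1) = 0 := fun a => by
      rw [← rho_fst, hg]; rfl
    have h2 : ∀ a : I₂, g.1 a.1 = 0 := fun a => by
      rw [← rho_snd, hg]; rfl
    have hsr : ∀ r, g.1 (s (Submodule.Quotient.mk r)) = g.1 r := by
      intro r
      have : s (Submodule.Quotient.mk r) - r ∈ I₂ := by
        rw [← Submodule.Quotient.eq, hs]
      rw [← sub_eq_zero, ← map_sub]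
      exact h2 ⟨_, this⟩
    refine ⟨⟨g.1 ∘ₗ s, fun v hv => ?_⟩, Subtype.ext (LinearMap.ext fun r => ?_)⟩
    · obtain ⟨r, rfl⟩ := Submodule.Quotient.mk_surjective _ v
      rw [LinearMap.comp_apply, hsr, mem_lineL]
      exact h1 ⟨r, (mk_mem_lineL h r).1 hv⟩
    · rw [kappa_apply, LinearMap.comp_apply, hsr]

lemma mulE_cyclic (S : Submodule ℂ (Rxy ⧸ I₂)) (h1 : Submodule.Quotient.mk (1 : Rxy) ∈ S)
    (hx : ∀ w ∈ S, mulE I₂ (X 0) w ∈ S) (hy : ∀ w ∈ S, mulE I₂ (X 1) w ∈ S) : S = ⊤ := by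
  rw [eq_top_iff]
  intro v _
  obtain ⟨r, rfl⟩ := Submodule.Quotient.mk_surjective _ v
  induction r using MvPolynomial.induction_on with
  | C c =>
    have := S.smul_mem c h1
    rw [← mul_one (C c), C_mul']
    exact this
  | add p q hp hq => exact S.add_mem (hp trivial) (hq trivial)
  | mul_X p i hp =>
    rw [mul_comm]
    fin_cases i
    · exact hx _ (hp trivial)
    · exact hy _ (hp trivial)

theorem tangent_finrank [FiniteDimensional ℂ (Rxy ⧸ I₂)] (hL : finrank ℂ (lineL h) = 1) :
    Module.rank ℂ (flagTangent2 I₁ I₂ h) = ((2 * finrank ℂ (Rxy ⧸ I₂) : ℕ) : Cardinal) := by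
  obtain ⟨s, hs0⟩ := LinearMap.exists_rightInverse_of_surjective
    ((Submodule.mkQ I₂).restrictScalars ℂ) (LinearMap.range_eq_top.2 (Submodule.mkQ_surjective I₂))
  have hs : ∀ v, Submodule.Quotient.mk (s v) = v := fun v => LinearMap.congr_fun hs0 v
  let ev : tanH h →ₗ[ℂ] Rxy ⧸ I₂ := (LinearMap.applyₗ (1 : Rxy)) ∘ₗ (tanH h).subtype
  refine count_rank (H := tanH h) (P := parab (lineL h) × parab (lineL h)) (U := Rxy ⧸ I₂)
    (T := flagTangent2 I₁ I₂ h) (A := parab (lineL h)) (psi h s hs) ev (rho h) (kappa h) _ (range_psi h s hs)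
    (ker_psi_inj h s hs) (ker_psi_surj h s hs) (rho_surj h) (kappa_inj h) (range_kappa h s hs) ?_
  refine finrank_ker_comMap (lineL h) hL _ _ (mulE_mem h _) (mulE_mem h _)
    (Submodule.Quotient.mk (1 : Rxy)) mulE_cyclic ?_
  · intro w
    obtain ⟨r, rfl⟩ := Submodule.Quotient.mk_surjective _ w
    refine ⟨mulE I₂ r, ?_, ?_, ?_⟩
    · rw [mulE_apply, ← Submodule.Quotient.mk_smul, smul_eq_mul, mul_one]
    · exact LinearMap.ext fun v => smul_comm r (X 0 : Rxy) v
    · exact LinearMap.ext fun v => smul_comm r (X 1 : Rxy) v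

end Tangent

/-- If `Γ₁ ⊆ Γ₂` have `n` and `n+1` boxes, then the tangent space at the corresponding
flag of monomial ideals has dimension `2n+2`. -/
theorem statement10 (n : ℕ) (Γ₁ Γ₂ : YoungDiagram)
    (hsub : Γ₁ ≤ Γ₂) (hc₁ : Γ₁.card = n) (hc₂ : Γ₂.card = n + 1)
    (h : monomialIdeal Γ₂ ≤ monomialIdeal Γ₁) :
    Module.rank ℂ ↥(flagTangent2 (monomialIdeal Γ₁) (monomialIdeal Γ₂) h)
      = ((2 * n + 2 : ℕ) : Cardinal) := by
  obtain ⟨hf1, hd1⟩ := colength Γ₁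
  obtain ⟨hf2, hd2⟩ := colength Γ₂
  have hL : Module.finrank ℂ (lineL h) = 1 := by
    have h1 := LinearMap.finrank_range_add_finrank_ker ((quotFactor h).restrictScalars ℂ)
    have h3 : LinearMap.range ((quotFactor h).restrictScalars ℂ) = ⊤ :=
      LinearMap.range_eq_top.2 (quotFactor_surj h)
    rw [h3, finrank_top, hd1, hd2, hc₁, hc₂] at h1
    have h2 : lineL h = LinearMap.ker ((quotFactor h).restrictScalars ℂ) := rfl
    rw [h2]
    omega
  rw [tangent_finrank h hL, hd2, hc₂]
  rfl
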